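/- arXiv:2010.07786 — 7 statements merged into one kernel-verified Lean document; each statement's English description precedes it below -/
import Mathlib

section
/- Assume a, c > 0 and b² = 27ac. Then the bulk energy density F satisfies F(Q) ≥ 0 for every Q ∈ 𝒬, and F(Q) = 0 if and only if Q = 0 or Q ∈ 𝒩 (i.e. Q = s₊(u⊗u − (1/3)I₃) for some unit vector u ∈ 𝕊²). -/
open Matrix

noncomputable section

/-- The configuration space `𝒬`: symmetric traceless `3 × 3` real matrices. -/
def isQ (Q : Matrix (Fin 3) (Fin 3) ℝ) : Prop := Q.IsSymm ∧ Q.trace = 0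

/-- The Landau--De Gennes bulk energy density
`F(Q) = (a/2) tr(Q²) − (b/3) tr(Q³) + (c/4) (tr Q²)²`. -/
def Fbulk (a b c : ℝ) (Q : Matrix (Fin 3) (Fin 3) ℝ) : ℝ :=
  a / 2 * (Q * Q).trace - b / 3 * (Q * Q * Q).trace + c / 4 * ((Q * Q).trace) ^ 2

/-- The uniaxial matrix `s (u ⊗ u − (1/3) I₃)`. -/
def uniax (s : ℝ) (u : Fin 3 → ℝ) : Matrix (Fin 3) (Fin 3) ℝ :=
  s • (vecMulVec u u - (1 / 3 : ℝ) • (1 : Matrix (Fin 3) (Fin 3) ℝ))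

/-- The traceless part of `Q² - (s/3) Q`, whose squared norm is the bulk energy density up to a
constant. -/
def uniaxDefect (s : ℝ) (Q : Matrix (Fin 3) (Fin 3) ℝ) : Matrix (Fin 3) (Fin 3) ℝ :=
  Q * Q - (s / 3) • Q - ((Q * Q).trace / 3) • (1 : Matrix (Fin 3) (Fin 3) ℝ)

theorem isQ.exists_entries {Q : Matrix (Fin 3) (Fin 3) ℝ} (hQ : isQ Q) :
    ∃ x y p q r : ℝ, Q = !![x, p, q; p, y, r; q, r, -x - y] := by
  obtain ⟨hs, ht⟩ := hQ
  refine ⟨Q 0 0, Q 1 1, Q 0 1, Q 0 2, Q 1 2, ?_⟩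
  rw [trace_fin_three] at ht
  have h01 := hs.apply 0 1
  have h02 := hs.apply 0 2
  have h12 := hs.apply 1 2
  ext i j
  fin_cases i <;> fin_cases j <;> simp <;> linarith

/-- The bulk energy density at the critical temperature as a sum of squares. -/
theorem Fbulk_eq_sum_sq (c s : ℝ) {Q : Matrix (Fin 3) (Fin 3) ℝ} (hQ : isQ Q) :
    Fbulk (c * s ^ 2 / 3) (3 * c * s) c Q =
      3 * c / 2 * ∑ i, ∑ j, uniaxDefect s Q i j ^ 2 := by
  obtain ⟨x, y, p, q, r, rfl⟩ := hQ.exists_entries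
  simp [Fbulk, uniaxDefect, trace_fin_three, Fin.sum_univ_three, one_apply]
  ring

/-- The Cayley--Hamilton identity for traceless symmetric matrices. -/
theorem isQ.cube_eq {Q : Matrix (Fin 3) (Fin 3) ℝ} (hQ : isQ Q) :
    Q * Q * Q = ((Q * Q).trace / 2) • Q +
      ((Q * Q * Q).trace / 3) • (1 : Matrix (Fin 3) (Fin 3) ℝ) := by
  obtain ⟨x, y, p, q, r, rfl⟩ := hQ.exists_entries
  ext i j
  fin_cases i <;> fin_cases j <;>
    simp [trace_fin_three, Fin.sum_univ_three, Matrix.mul_apply] <;> ring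

/-- A symmetric idempotent `3 × 3` real matrix of trace one projects onto a line. -/
theorem exists_eq_vecMulVec_of_idempotent {M : Matrix (Fin 3) (Fin 3) ℝ} (hs : M.IsSymm)
    (ht : M.trace = 1) (hM : M * M = M) :
    ∃ u : Fin 3 → ℝ, u ⬝ᵥ u = 1 ∧ M = vecMulVec u u := by
  have hsq (i j : Fin 3) : M i 0 * M 0 j + M i 1 * M 1 j + M i 2 * M 2 j = M i j := by
    simpa [Matrix.mul_apply, Fin.sum_univ_three] using congrFun (congrFun hM i) j
  have hminor (i j k : Fin 3) : M i j * M i k = M i i * M j k := by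
    rw [trace_fin_three] at ht
    have h10 := hs.apply 0 1
    have h20 := hs.apply 0 2
    have h21 := hs.apply 1 2
    have h00' := hsq 0 0
    have h01' := hsq 0 1
    have h02' := hsq 0 2
    have h11' := hsq 1 1
    have h12' := hsq 1 2
    have h22' := hsq 2 2
    simp only [h10, h20, h21] at h00' h01' h02' h11' h12' h22'
    fin_cases i <;> fin_cases j <;> fin_cases k <;> simp only [Fin.zero_eta, Fin.mk_one,
      Fin.reduceFinMk, h10, h20, h21] <;> grobner
  obtain ⟨i, hi⟩ : ∃ i, 0 < M i i := by
    by_contra! h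
    rw [trace_fin_three] at ht
    linarith [h 0, h 1, h 2]
  have hsqrt := Real.mul_self_sqrt hi.le
  have hM' : M = vecMulVec (fun j => M i j / √(M i i)) (fun j => M i j / √(M i i)) := by
    ext j k
    rw [vecMulVec_apply, div_mul_div_comm, hsqrt, hminor, mul_div_cancel_left₀ _ hi.ne']
  refine ⟨_, ?_, hM'⟩
  rw [← trace_vecMulVec, ← hM', ht]

theorem uniaxDefect_uniax (s : ℝ) {u : Fin 3 → ℝ} (hu : u ⬝ᵥ u = 1) :
    uniaxDefect s (uniax s u) = 0 := by
  have hP : vecMulVec u u * vecMulVec u u = vecMulVec u u := by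
    rw [vecMulVec_mul_vecMulVec, hu, one_smul]
  have hsq : uniax s u * uniax s u =
      (s / 3) • uniax s u + (2 * s ^ 2 / 9) • (1 : Matrix (Fin 3) (Fin 3) ℝ) := by
    simp only [uniax, sub_mul, mul_sub, hP, smul_mul_assoc, mul_smul_comm,
      one_mul, mul_one]
    module
  have htr : (uniax s u).trace = 0 := by
    simp [uniax, trace_vecMulVec, hu]
  have htr2 : (uniax s u * uniax s u).trace = 2 * s ^ 2 / 3 := by
    rw [hsq, trace_add, trace_smul, trace_smul, htr, trace_one]
    simp
    ring
  rw [uniaxDefect, htr2, hsq]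
  module

theorem uniaxDefect_eq_zero_iff {s : ℝ} (hs : s ≠ 0) {Q : Matrix (Fin 3) (Fin 3) ℝ} (hQ : isQ Q) :
    uniaxDefect s Q = 0 ↔ Q = 0 ∨ ∃ u : Fin 3 → ℝ, u ⬝ᵥ u = 1 ∧ Q = uniax s u := by
  refine ⟨fun h => ?_, ?_⟩
  · have hsq : Q * Q = (s / 3) • Q + ((Q * Q).trace / 3) • (1 : Matrix (Fin 3) (Fin 3) ℝ) := by
      rwa [uniaxDefect, sub_sub, sub_eq_zero] at h
    have hcube : Q * Q * Q = (s / 3) • (Q * Q) + ((Q * Q).trace / 3) • Q := by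
      conv_lhs => rw [hsq]
      rw [add_mul, smul_mul_assoc, smul_mul_assoc, one_mul]
    have htr : (Q * Q * Q).trace = s / 3 * (Q * Q).trace := by
      rw [hcube, trace_add, trace_smul, trace_smul, hQ.2]
      simp
    have hcube' := hQ.cube_eq
    rw [htr] at hcube'
    generalize (Q * Q).trace = t at *
    have hzero : (t / 6 - s ^ 2 / 9) • Q = 0 := by
      rw [hcube, hsq] at hcube'
      rw [← sub_eq_zero.2 hcube'.symm]
      module
    rcases smul_eq_zero.1 hzero with ht | h0
    · right
      obtain rfl : t = 2 * s ^ 2 / 3 := by linarith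
      obtain ⟨u, hu, hMu⟩ := exists_eq_vecMulVec_of_idempotent
        (M := s⁻¹ • Q + (1 / 3 : ℝ) • (1 : Matrix (Fin 3) (Fin 3) ℝ))
        ((hQ.1.smul _).add (isSymm_one.smul _))
        (by rw [trace_add, trace_smul, trace_smul, hQ.2, trace_one]; simp)
        (by
          simp only [add_mul, mul_add, smul_mul_assoc, mul_smul_comm, one_mul, mul_one, hsq]
          match_scalars <;> field_simp <;> norm_num)
      refine ⟨u, hu, ?_⟩
      rw [uniax, ← hMu, add_sub_cancel_right, smul_inv_smul₀ hs]
    · exact Or.inl h0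
  · rintro (rfl | ⟨u, hu, rfl⟩)
    · simp [uniaxDefect]
    · exact uniaxDefect_uniax s hu

/-- at the critical temperature (`b² = 27 a c`, `a, b, c > 0`), the bulk energy
density is nonnegative on `𝒬` and vanishes exactly on `{0} ∪ 𝒩`, where
`𝒩 = {s₊ (u ⊗ u − I₃/3) : u ∈ 𝕊²}` with `s₊ = √(3a/c)`. -/
theorem stmt0 (a b c : ℝ) (ha : 0 < a) (hb : 0 < b) (hc : 0 < c)
    (habc : b ^ 2 = 27 * a * c) (Q : Matrix (Fin 3) (Fin 3) ℝ) (hQ : isQ Q) :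
    0 ≤ Fbulk a b c Q ∧
      (Fbulk a b c Q = 0 ↔
        Q = 0 ∨ ∃ u : Fin 3 → ℝ, u ⬝ᵥ u = 1 ∧ Q = uniax (Real.sqrt (3 * a / c)) u) := by
  have hs : 0 < √(3 * a / c) := Real.sqrt_pos.2 (by positivity)
  have hs2 : √(3 * a / c) ^ 2 = 3 * a / c := Real.sq_sqrt (by positivity)
  generalize √(3 * a / c) = s at *
  obtain rfl : a = c * s ^ 2 / 3 := by
    rw [hs2]
    field_simp
  obtain rfl : b = 3 * c * s := by
    rw [← sq_eq_sq₀ hb.le (by positivity), habc]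
    ring
  rw [Fbulk_eq_sum_sq c s hQ, ← uniaxDefect_eq_zero_iff hs.ne' hQ]
  refine ⟨by positivity, ⟨fun h => ?_, fun h => by simp [h]⟩⟩
  have hsum := (mul_eq_zero.1 h).resolve_left (by positivity)
  ext i j
  rw [Finset.sum_eq_zero_iff_of_nonneg fun _ _ => by positivity] at hsum
  have hrow := hsum i (Finset.mem_univ i)
  rw [Finset.sum_eq_zero_iff_of_nonneg fun _ _ => by positivity] at hrow
  exact pow_eq_zero_iff two_ne_zero |>.1 (hrow j (Finset.mem_univ j))
end
end

section
/- Assume a, c > 0 and b² = 27ac, and set s₊ := √(3a/c). If Q = s₀(u⊗u − (1/3)I₃) for some s₀ ∈ [0, s₊] and some unit vector u ∈ 𝕊², then d^F(Q) = (2/√3)·∫_{s₀}^{s₊} √(f(τ)) dτ, where f(s) = (s²/27)(9a − 2bs + 3cs²). -/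
open Matrix MeasureTheory

noncomputable section

attribute [local instance] Matrix.frobeniusNormedAddCommGroup Matrix.frobeniusNormedSpace

/-- The Frobenius norm `|Q| = √(tr(Qᵀ Q))`. -/
def fnorm (Q : Matrix (Fin 3) (Fin 3) ℝ) : ℝ := Real.sqrt ((Qᵀ * Q).trace)

/-- The nematic manifold `𝒩 = {s₊ (u ⊗ u − I₃/3) : u ∈ 𝕊²}` with `s₊ = √(3a/c)`. -/
def NSet (a c : ℝ) : Set (Matrix (Fin 3) (Fin 3) ℝ) :=
  {Q | ∃ u : Fin 3 → ℝ, u ⬝ᵥ u = 1 ∧ Q = uniax (Real.sqrt (3 * a / c)) u}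

/-- Admissible paths for the quasi-distance: Lipschitz paths `γ : [0,1] → 𝒬` starting
on `𝒩` and ending at `q`. -/
def admissible (a c : ℝ) (q : Matrix (Fin 3) (Fin 3) ℝ)
    (γ : ℝ → Matrix (Fin 3) (Fin 3) ℝ) : Prop :=
  (∃ K : NNReal, LipschitzOnWith K γ (Set.Icc 0 1)) ∧
    (∀ t ∈ Set.Icc (0 : ℝ) 1, isQ (γ t)) ∧ γ 0 ∈ NSet a c ∧ γ 1 = q

/-- The quasi-distance `d^F(q) = inf ∫₀¹ √(2F(γ)) |γ'| dt` over admissible paths. -/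
def dF (a b c : ℝ) (q : Matrix (Fin 3) (Fin 3) ℝ) : ℝ :=
  sInf {e : ℝ | ∃ γ : ℝ → Matrix (Fin 3) (Fin 3) ℝ, admissible a c q γ ∧
    e = ∫ t in (0 : ℝ)..1, Real.sqrt (2 * Fbulk a b c (γ t)) * fnorm (deriv γ t)}

/-- The bulk energy density on uniaxial matrices: `f(s) = (s²/27)(9a − 2bs + 3cs²)`. -/
def fb (a b c s : ℝ) : ℝ := s ^ 2 / 27 * (9 * a - 2 * b * s + 3 * c * s ^ 2)

lemma fnorm_eq_norm (Q : Matrix (Fin 3) (Fin 3) ℝ) : fnorm Q = ‖Q‖ := by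
  rw [fnorm, Matrix.frobenius_norm_def, ← Real.sqrt_eq_rpow]
  congr 1
  simp only [trace, diag_apply, mul_apply, transpose_apply, Real.norm_eq_abs, Real.rpow_two,
    sq_abs]
  rw [Finset.sum_comm]
  simp only [sq]

lemma trace_uniax_sq (s : ℝ) {u : Fin 3 → ℝ} (hu : u ⬝ᵥ u = 1) :
    (uniax s u * uniax s u).trace = 2 / 3 * s ^ 2 := by
  simp only [dotProduct, Fin.sum_univ_three] at hu
  simp [uniax, trace, mul_apply, vecMulVec_apply, Fin.sum_univ_three, one_apply]
  linear_combination s ^ 2 * (u 0 * u 0 + u 1 * u 1 + u 2 * u 2 + 1 / 3) * hu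

lemma trace_uniax_cube (s : ℝ) {u : Fin 3 → ℝ} (hu : u ⬝ᵥ u = 1) :
    (uniax s u * uniax s u * uniax s u).trace = 2 / 9 * s ^ 3 := by
  simp only [dotProduct, Fin.sum_univ_three] at hu
  simp [uniax, trace, mul_apply, vecMulVec_apply, Fin.sum_univ_three, one_apply]
  linear_combination s ^ 3 * ((u 0 * u 0 + u 1 * u 1 + u 2 * u 2) ^ 2 + 1 / 3) * hu

lemma isQ_uniax (s : ℝ) {u : Fin 3 → ℝ} (hu : u ⬝ᵥ u = 1) : isQ (uniax s u) := by
  simp only [dotProduct, Fin.sum_univ_three] at hu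
  constructor
  · ext i j
    simp [uniax, vecMulVec_apply, one_apply, mul_comm, eq_comm]
  · simp [uniax, trace, vecMulVec_apply, Fin.sum_univ_three]
    linear_combination s * hu

lemma Fbulk_uniax (a b c s : ℝ) {u : Fin 3 → ℝ} (hu : u ⬝ᵥ u = 1) :
    Fbulk a b c (uniax s u) = fb a b c s := by
  rw [Fbulk, fb, trace_uniax_sq s hu, trace_uniax_cube s hu]
  ring

lemma isQ.trace_sq {Q : Matrix (Fin 3) (Fin 3) ℝ} (hQ : isQ Q) : (Q * Q).trace = ‖Q‖ ^ 2 := by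
  have h : 0 ≤ (Qᵀ * Q).trace := by
    simp only [trace, diag_apply, mul_apply, transpose_apply]
    exact Finset.sum_nonneg fun _ _ => Finset.sum_nonneg fun _ _ => mul_self_nonneg _
  rw [← fnorm_eq_norm, fnorm, Real.sq_sqrt h, hQ.1.eq]

lemma norm_uniax {s : ℝ} (hs : 0 ≤ s) {u : Fin 3 → ℝ} (hu : u ⬝ᵥ u = 1) :
    ‖uniax s u‖ = √(2 / 3) * s := by
  rw [← fnorm_eq_norm, fnorm, (isQ_uniax s hu).1.eq, trace_uniax_sq s hu,
    Real.sqrt_mul (by norm_num), Real.sqrt_sq hs]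

/-- The traces of the square and the cube of a real symmetric matrix are power sums of its
eigenvalues. -/
lemma exists_trace_eq_power_sums {Q : Matrix (Fin 3) (Fin 3) ℝ} (hQ : Q.IsSymm) :
    ∃ x : Fin 3 → ℝ, Q.trace = ∑ i, x i ∧ (Q * Q).trace = ∑ i, x i ^ 2 ∧
      (Q * Q * Q).trace = ∑ i, x i ^ 3 := by
  have hH : Q.IsHermitian := by rwa [IsHermitian, conjTranspose_eq_transpose_of_trivial]
  have tr : ∀ D : Matrix (Fin 3) (Fin 3) ℝ,
      (Unitary.conjStarAlgAut ℝ _ hH.eigenvectorUnitary D).trace = D.trace := by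
    intro D
    rw [Unitary.conjStarAlgAut_apply, trace_mul_comm, ← mul_assoc]
    simp
  refine ⟨hH.eigenvalues, ?_, ?_, ?_⟩
  · simpa using hH.trace_eq_sum_eigenvalues
  · conv_lhs => rw [hH.spectral_theorem, ← map_mul, tr]
    simp [diagonal_mul_diagonal, trace_diagonal, sq]
  · conv_lhs => rw [hH.spectral_theorem, ← map_mul, ← map_mul, tr]
    simp [diagonal_mul_diagonal, trace_diagonal, pow_succ]

lemma six_mul_trace_cube_sq_le {Q : Matrix (Fin 3) (Fin 3) ℝ} (hQ : isQ Q) :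
    6 * (Q * Q * Q).trace ^ 2 ≤ (Q * Q).trace ^ 3 := by
  obtain ⟨x, h1, h2, h3⟩ := exists_trace_eq_power_sums hQ.1
  rw [hQ.2] at h1
  simp only [Fin.sum_univ_three] at h1 h2 h3
  have hx : x 2 = - x 0 - x 1 := by linarith
  rw [h2, h3, hx]
  linarith [sq_nonneg ((x 0 - x 1) * (2 * x 0 + x 1) * (x 0 + 2 * x 1)),
    show (x 0 ^ 2 + x 1 ^ 2 + (-x 0 - x 1) ^ 2) ^ 3
        - 6 * (x 0 ^ 3 + x 1 ^ 3 + (-x 0 - x 1) ^ 3) ^ 2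
        = 2 * ((x 0 - x 1) * (2 * x 0 + x 1) * (x 0 + 2 * x 1)) ^ 2 by ring]

/-- Among all matrices of given norm, the uniaxial ones with nonnegative order parameter minimize
the bulk energy. -/
lemma fb_le_Fbulk {a b c : ℝ} (hb : 0 ≤ b) {Q : Matrix (Fin 3) (Fin 3) ℝ} (hQ : isQ Q) :
    fb a b c (√(3 / 2) * ‖Q‖) ≤ Fbulk a b c Q := by
  set s := √(3 / 2) * ‖Q‖ with hs
  have hs0 : 0 ≤ s := by positivity
  have h2 : (Q * Q).trace = 2 / 3 * s ^ 2 := by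
    rw [hQ.trace_sq, hs, mul_pow, Real.sq_sqrt (by norm_num)]
    ring
  have h3 : (Q * Q * Q).trace ≤ 2 / 9 * s ^ 3 := by
    refine (abs_le_of_sq_le_sq' ?_ (by positivity)).2
    have := six_mul_trace_cube_sq_le hQ
    rw [h2] at this
    linarith [show (2 / 3 * s ^ 2) ^ 3 = 6 * (2 / 9 * s ^ 3) ^ 2 by ring]
  rw [Fbulk, fb, h2]
  nlinarith [mul_le_mul_of_nonneg_left h3 hb]

lemma abs_deriv_norm_le {E : Type*} [NormedAddCommGroup E] [NormedSpace ℝ E] {γ : ℝ → E} {t : ℝ}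
    (hγ : DifferentiableAt ℝ γ t) (hr : DifferentiableAt ℝ (fun s => ‖γ s‖) t) :
    |deriv (fun s => ‖γ s‖) t| ≤ ‖deriv γ t‖ := by
  have h1 := (hasDerivAt_iff_tendsto_slope.1 hr.hasDerivAt).abs
  have h2 := (hasDerivAt_iff_tendsto_slope.1 hγ.hasDerivAt).norm
  refine le_of_tendsto_of_tendsto' h1 h2 fun s => ?_
  rw [slope_def_field, slope_def_module, norm_smul, abs_div, div_eq_inv_mul, norm_inv,
    Real.norm_eq_abs]
  gcongr
  exact abs_norm_sub_norm_le _ _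

section Critical

variable {a b c : ℝ}

/-- At the critical temperature the bulk energy is a perfect square on uniaxial matrices. -/
lemma fb_eq_sq (ha : 0 < a) (hb : 0 < b) (hc : 0 < c) (habc : b ^ 2 = 27 * a * c) (s : ℝ) :
    fb a b c s = (√c / 3 * (s * (√(3 * a / c) - s))) ^ 2 := by
  set S := √(3 * a / c) with hS
  have hS0 : 0 ≤ S := Real.sqrt_nonneg _
  have h1 : a = c * S ^ 2 / 3 := by
    rw [hS, Real.sq_sqrt (by positivity)]
    field_simp
  have h2 : b = 3 * c * S := by
    rw [← sq_eq_sq₀ hb.le (by positivity), habc, h1]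
    ring
  rw [fb, mul_pow, div_pow, Real.sq_sqrt hc.le, h2, h1]
  ring

lemma sqrt_fb (ha : 0 < a) (hb : 0 < b) (hc : 0 < c) (habc : b ^ 2 = 27 * a * c) (s : ℝ) :
    √(fb a b c s) = √c / 3 * |s * (√(3 * a / c) - s)| := by
  rw [fb_eq_sq ha hb hc habc, Real.sqrt_sq_eq_abs, abs_mul, abs_of_nonneg (by positivity)]

lemma integral_sqrt_fb (ha : 0 < a) (hb : 0 < b) (hc : 0 < c) (habc : b ^ 2 = 27 * a * c) {s₀ : ℝ}
    (hs₀ : s₀ ∈ Set.Icc (0 : ℝ) (√(3 * a / c))) :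
    ∫ τ in s₀..√(3 * a / c), √(fb a b c τ) =
      √c / 3 * (√(3 * a / c) ^ 3 / 6 - (√(3 * a / c) * s₀ ^ 2 / 2 - s₀ ^ 3 / 3)) := by
  have key : ∀ τ ∈ Set.uIcc s₀ √(3 * a / c),
      HasDerivAt (fun x => √c / 3 * (√(3 * a / c) * x ^ 2 / 2 - x ^ 3 / 3)) √(fb a b c τ) τ := by
    intro τ hτ
    rw [Set.uIcc_of_le hs₀.2] at hτ
    rw [sqrt_fb ha hb hc habc, abs_of_nonneg
      (mul_nonneg (hs₀.1.trans hτ.1) (sub_nonneg.2 hτ.2))]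
    refine (((((hasDerivAt_pow 2 τ).const_mul √(3 * a / c)).div_const 2).sub
      ((hasDerivAt_pow 3 τ).div_const 3)).const_mul (√c / 3)).congr_deriv ?_
    push_cast
    ring
  rw [intervalIntegral.integral_eq_sub_of_hasDerivAt key]
  · ring
  · apply Continuous.intervalIntegrable
    unfold fb
    fun_prop

/-- The length density along a path dominates the derivative of a primitive of `√f` evaluated at
the order parameter `√(3/2) |γ|`. -/
lemma energy_density_ge (ha : 0 < a) (hb : 0 < b) (hc : 0 < c) (habc : b ^ 2 = 27 * a * c)
    {Q V : Matrix (Fin 3) (Fin 3) ℝ} (hQ : isQ Q) {r : ℝ} (hr : |r| ≤ ‖V‖) :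
    2 / √3 * (√c / 3) * |√(3 / 2) * ‖Q‖ * (√(3 * a / c) - √(3 / 2) * ‖Q‖) * (√(3 / 2) * r)| ≤
      √(2 * Fbulk a b c Q) * fnorm V := by
  have h := Real.sqrt_le_sqrt (fb_le_Fbulk (a := a) (c := c) hb.le hQ)
  rw [sqrt_fb ha hb hc habc] at h
  have h3 : 2 / √3 * √(3 / 2) = √2 := by
    rw [Real.sqrt_div (by norm_num)]
    have h2 : √2 * √2 = 2 := Real.mul_self_sqrt (by norm_num)
    have : √3 ≠ 0 := by positivity
    field_simp
    linarith
  rw [fnorm_eq_norm, Real.sqrt_mul (by norm_num), abs_mul _ (√(3 / 2) * r), abs_mul _ r,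
    abs_of_nonneg (Real.sqrt_nonneg (3 / 2))]
  calc _ = (2 / √3 * √(3 / 2)) *
        (√c / 3 * |√(3 / 2) * ‖Q‖ * (√(3 * a / c) - √(3 / 2) * ‖Q‖)|) * |r| := by ring
    _ ≤ _ := by
        rw [h3]
        gcongr

end Critical

lemma intervalIntegrable_energy (a b c : ℝ) {γ : ℝ → Matrix (Fin 3) (Fin 3) ℝ} {K : NNReal}
    (hγ : LipschitzOnWith K γ (Set.Icc 0 1)) :
    IntervalIntegrable (fun t => √(2 * Fbulk a b c (γ t)) * fnorm (deriv γ t)) volume 0 1 := by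
  have hF : Continuous fun Q => √(2 * Fbulk a b c Q) := by
    unfold Fbulk
    fun_prop
  have hcont : ContinuousOn (fun t => √(2 * Fbulk a b c (γ t))) (Set.uIcc 0 1) := by
    rw [Set.uIcc_of_le zero_le_one]
    exact hF.comp_continuousOn hγ.continuousOn
  refine IntervalIntegrable.continuousOn_mul ?_ hcont
  simp only [fnorm_eq_norm]
  rw [intervalIntegrable_iff_integrableOn_Ioo_of_le zero_le_one]
  refine Integrable.mono' (g := fun _ => (K : ℝ)) (by simp)
    (stronglyMeasurable_deriv γ).norm.aestronglyMeasurable ?_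
  filter_upwards [ae_restrict_mem measurableSet_Ioo] with t ht
  rw [norm_norm]
  exact norm_deriv_le_of_lipschitzOn (Icc_mem_nhds ht.1 ht.2) hγ

/-- The affine path along the uniaxial half-line realizes the one-dimensional energy. -/
lemma exists_admissible_energy_eq {a b c s₀ : ℝ} (hs₀ : s₀ ∈ Set.Icc (0 : ℝ) (√(3 * a / c)))
    {u : Fin 3 → ℝ} (hu : u ⬝ᵥ u = 1) :
    ∃ γ : ℝ → Matrix (Fin 3) (Fin 3) ℝ, admissible a c (uniax s₀ u) γ ∧
      2 / √3 * ∫ τ in s₀..√(3 * a / c), √(fb a b c τ) =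
        ∫ t in (0 : ℝ)..1, √(2 * Fbulk a b c (γ t)) * fnorm (deriv γ t) := by
  set S := √(3 * a / c) with hS
  have hγ : ∀ t, HasDerivAt (fun t : ℝ => uniax (S - (S - s₀) * t) u) (-uniax (S - s₀) u) t := by
    intro t
    have h : HasDerivAt (fun t : ℝ => S - (S - s₀) * t) (-(S - s₀)) t := by
      simpa using ((hasDerivAt_id t).const_mul (S - s₀)).const_sub S
    have h' := h.smul_const (vecMulVec u u - (1 / 3 : ℝ) • (1 : Matrix (Fin 3) (Fin 3) ℝ))
    rw [neg_smul] at h'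
    exact h'
  have hd : ∀ t, deriv (fun t : ℝ => uniax (S - (S - s₀) * t) u) t = -uniax (S - s₀) u :=
    fun t => (hγ t).deriv
  refine ⟨fun t => uniax (S - (S - s₀) * t) u, ⟨⟨‖uniax (S - s₀) u‖₊, ?_⟩,
    fun t _ => isQ_uniax _ hu, ⟨u, hu, by simp [hS]⟩, by simp⟩, ?_⟩
  · refine (lipschitzWith_of_nnnorm_deriv_le (fun t => (hγ t).differentiableAt)
      fun t => ?_).lipschitzOnWith
    rw [(hγ t).deriv, nnnorm_neg]
  · have h2 : √2 * √(2 / 3) = 2 / √3 := by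
      rw [← Real.sqrt_mul (by norm_num), show (2 : ℝ) * (2 / 3) = 2 ^ 2 / 3 by norm_num,
        Real.sqrt_div (by norm_num), Real.sqrt_sq (by norm_num)]
    have h : ∀ t, √(2 * Fbulk a b c (uniax (S - (S - s₀) * t) u)) *
        fnorm (deriv (fun t : ℝ => uniax (S - (S - s₀) * t) u) t) =
        2 / √3 * ((S - s₀) * √(fb a b c (S - (S - s₀) * t))) := by
      intro t
      rw [hd, fnorm_eq_norm, norm_neg, norm_uniax (sub_nonneg.2 hs₀.2) hu,
        Fbulk_uniax _ _ _ _ hu, Real.sqrt_mul (by norm_num), ← h2]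
      ring
    simp only [h]
    rw [intervalIntegral.integral_const_mul, intervalIntegral.integral_const_mul,
      intervalIntegral.mul_integral_comp_sub_mul (f := fun τ => √(fb a b c τ))]
    simp

/-- Every admissible path has at least the one-dimensional energy: the primitive of `√f`, evaluated
at the order parameter `√(3/2) |γ|`, is a calibration. -/
lemma le_energy_of_admissible {a b c : ℝ} (ha : 0 < a) (hb : 0 < b) (hc : 0 < c)
    (habc : b ^ 2 = 27 * a * c) {s₀ : ℝ} (hs₀ : s₀ ∈ Set.Icc (0 : ℝ) (√(3 * a / c)))
    {u : Fin 3 → ℝ} (hu : u ⬝ᵥ u = 1) {γ : ℝ → Matrix (Fin 3) (Fin 3) ℝ}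
    (hγ : admissible a c (uniax s₀ u) γ) :
    2 / √3 * ∫ τ in s₀..√(3 * a / c), √(fb a b c τ) ≤
      ∫ t in (0 : ℝ)..1, √(2 * Fbulk a b c (γ t)) * fnorm (deriv γ t) := by
  obtain ⟨⟨K, hK⟩, hQ, ⟨v, hv, h0⟩, h1⟩ := hγ
  rw [integral_sqrt_fb ha hb hc habc hs₀]
  have hS0 : 0 ≤ √(3 * a / c) := Real.sqrt_nonneg _
  have hsqrt : √(3 / 2) * √(2 / 3) = 1 := by
    rw [← Real.sqrt_mul (by norm_num)]
    norm_num
  have hbd {Q V : Matrix (Fin 3) (Fin 3) ℝ} (hQ : isQ Q) {r : ℝ} (hr : |r| ≤ ‖V‖) :=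
    energy_density_ge ha hb hc habc hQ hr
  set S := √(3 * a / c) with hS
  set κ := 2 / √3 * (√c / 3) with hκ
  set r : ℝ → ℝ := fun t => ‖γ t‖ with hr
  have hrAC : AbsolutelyContinuousOnInterval r 0 1 := by
    apply LipschitzOnWith.absolutelyContinuousOnInterval (K := 1 * K)
    rw [Set.uIcc_of_le zero_le_one]
    exact lipschitzWith_one_norm.comp_lipschitzOnWith hK
  set p : ℝ → ℝ := fun x => κ * (S * (√(3 / 2) * x) ^ 2 / 2 - (√(3 / 2) * x) ^ 3 / 3) with hp
  have hpAC : AbsolutelyContinuousOnInterval (fun t => p (r t)) 0 1 := by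
    have h2 := hrAC.fun_mul hrAC
    have h3 := h2.fun_mul hrAC
    have h := (h2.const_mul (κ * (S * √(3 / 2) ^ 2 / 2))).sub (h3.const_mul (κ * √(3 / 2) ^ 3 / 3))
    refine (congrArg (AbsolutelyContinuousOnInterval · 0 1) (funext fun t => ?_)).mp h
    simp only [hp, Pi.sub_apply]
    ring
  have hp' : ∀ x, HasDerivAt p (κ * (√(3 / 2) * x * (S - √(3 / 2) * x) * √(3 / 2))) x := by
    intro x
    have hl : HasDerivAt (fun x => √(3 / 2) * x) √(3 / 2) x := by
      simpa using (hasDerivAt_id x).const_mul √(3 / 2)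
    refine (((((hl.pow 2).const_mul S).div_const 2).sub
      ((hl.pow 3).div_const 3)).const_mul κ).congr_deriv ?_
    push_cast
    ring
  have hκ0 : 0 ≤ κ := by positivity
  have hend : p (r 0) - p (r 1) =
      2 / √3 * (√c / 3 * (S ^ 3 / 6 - (S * s₀ ^ 2 / 2 - s₀ ^ 3 / 3))) := by
    simp only [hp, hr]
    rw [h0, h1, norm_uniax hS0 hv, norm_uniax hs₀.1 hu, ← mul_assoc, ← mul_assoc, hsqrt, hκ]
    ring
  calc _ = ∫ t in (0 : ℝ)..1, -deriv (fun t => p (r t)) t := by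
        rw [intervalIntegral.integral_neg, hpAC.integral_deriv_eq_sub, neg_sub, hend]
    _ ≤ _ := by
        refine intervalIntegral.integral_mono_ae_restrict zero_le_one
          hpAC.intervalIntegrable_deriv.neg (intervalIntegrable_energy a b c hK) ?_
        rw [← Measure.restrict_congr_set Ioo_ae_eq_Icc]
        filter_upwards [ae_restrict_mem measurableSet_Ioo,
          ae_restrict_of_ae hK.ae_differentiableWithinAt_of_mem,
          ae_restrict_of_ae hrAC.ae_differentiableAt] with t ht hγt hrt
        have htI := Set.Ioo_subset_Icc_self ht
        have hγt := (hγt htI).differentiableAt (Icc_mem_nhds ht.1 ht.2)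
        have hrt := hrt (by rwa [Set.uIcc_of_le zero_le_one])
        have hchain : deriv (fun t => p (r t)) t =
            κ * (√(3 / 2) * r t * (S - √(3 / 2) * r t) * (√(3 / 2) * deriv r t)) := by
          rw [← Function.comp_def p r, ((hp' (r t)).comp t hrt.hasDerivAt).deriv]
          ring
        refine le_trans ?_ (hbd (hQ t htI) (abs_deriv_norm_le hγt hrt))
        rw [hchain, ← mul_neg]
        exact mul_le_mul_of_nonneg_left (neg_le_abs _) hκ0

/-- for `s₀ ∈ [0, s₊]` and a unit vector `u ∈ 𝕊²`, the quasi-distance of the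
uniaxial matrix `Q = s₀ (u ⊗ u − I₃/3)` is `d^F(Q) = (2/√3) ∫_{s₀}^{s₊} √(f(τ)) dτ`. -/
theorem stmt4 (a b c : ℝ) (ha : 0 < a) (hb : 0 < b) (hc : 0 < c)
    (habc : b ^ 2 = 27 * a * c) (s₀ : ℝ)
    (hs₀ : s₀ ∈ Set.Icc (0 : ℝ) (Real.sqrt (3 * a / c)))
    (u : Fin 3 → ℝ) (hu : u ⬝ᵥ u = 1) :
    dF a b c (uniax s₀ u) =
      2 / Real.sqrt 3 * ∫ τ in s₀..(Real.sqrt (3 * a / c)), Real.sqrt (fb a b c τ) := by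
  refine IsLeast.csInf_eq ⟨exists_admissible_energy_eq hs₀ hu, ?_⟩
  rintro e ⟨γ, hγ, rfl⟩
  exact le_energy_of_admissible ha hb hc habc hs₀ hu hγ
end
end

section
/- Let λ₁, λ₂, λ₃ : ℝ → ℝ and n₁, n₂, n₃ : ℝ → ℝ³ be differentiable at t₀, and suppose {n₁(t), n₂(t), n₃(t)} is an orthonormal set in ℝ³ for every t in a neighborhood of t₀. Define γ(t) = Σ_{i=1}^{3} λᵢ(t)·nᵢ(t)⊗nᵢ(t). Then the Frobenius norm of γ'(t₀) satisfies |γ'(t₀)|² = Σ_{i=1}^{3}(λᵢ'(t₀))² + Σ_{1≤i<j≤3} 2(λᵢ(t₀)(nⱼ(t₀)·nᵢ'(t₀)) + λⱼ(t₀)(nᵢ(t₀)·nⱼ'(t₀)))²; in particular |γ'(t₀)|² ≥ (λ₁'(t₀))² + (λ₂'(t₀))² + (λ₃'(t₀))². -/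
open Matrix

noncomputable section

attribute [local instance] Matrix.frobeniusNormedAddCommGroup Matrix.frobeniusNormedSpace

/-- A matrix-valued function is differentiable when its entries are. -/
theorem hasDerivAt_matrix_of_entries {A : ℝ → Matrix (Fin 3) (Fin 3) ℝ}
    {A' : Matrix (Fin 3) (Fin 3) ℝ} {t : ℝ}
    (h : ∀ a b, HasDerivAt (fun s => A s a b) (A' a b) t) : HasDerivAt A A' t := by
  have key : HasDerivAt (fun s => ∑ a : Fin 3, ∑ b : Fin 3, A s a b • single a b (1 : ℝ))
      (∑ a : Fin 3, ∑ b : Fin 3, A' a b • single a b (1 : ℝ)) t :=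
    HasDerivAt.fun_sum fun a _ => HasDerivAt.fun_sum fun b _ => (h a b).smul_const _
  have expand (M : Matrix (Fin 3) (Fin 3) ℝ) :
      ∑ a : Fin 3, ∑ b : Fin 3, M a b • single a b (1 : ℝ) = M := by
    conv_rhs => rw [matrix_eq_sum_single M]
    simp [smul_single]
  simpa only [expand] using key

/-- The product rule for the dot product of two vector-valued functions. -/
theorem hasDerivAt_dotProduct {u v : ℝ → Fin 3 → ℝ} {u' v' : Fin 3 → ℝ} {t : ℝ}
    (hu : HasDerivAt u u' t) (hv : HasDerivAt v v' t) :
    HasDerivAt (fun s => u s ⬝ᵥ v s) (u' ⬝ᵥ v t + u t ⬝ᵥ v') t := by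
  simp only [dotProduct, ← Finset.sum_add_distrib]
  exact HasDerivAt.fun_sum fun a _ => (hasDerivAt_pi.1 hu a).fun_mul (hasDerivAt_pi.1 hv a)

/-- The squared Frobenius norm is the sum of the squared entries. -/
theorem fnorm_sq (Q : Matrix (Fin 3) (Fin 3) ℝ) :
    fnorm Q ^ 2 = ∑ i : Fin 3, ∑ j : Fin 3, Q i j ^ 2 := by
  have h : (Qᵀ * Q).trace = ∑ i : Fin 3, ∑ j : Fin 3, Q i j ^ 2 := by
    rw [Finset.sum_comm]
    simp [trace, mul_apply, sq]
  rw [fnorm, h, Real.sq_sqrt (by positivity)]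

/-- The Frobenius norm is invariant under orthogonal conjugation. -/
theorem fnorm_conj {N : Matrix (Fin 3) (Fin 3) ℝ} (hN : N * Nᵀ = 1)
    (Q : Matrix (Fin 3) (Fin 3) ℝ) : fnorm (N * Q * Nᵀ) = fnorm Q := by
  have hN' : Nᵀ * N = 1 := mul_eq_one_comm.1 hN
  have h : (N * Q * Nᵀ)ᵀ * (N * Q * Nᵀ) = N * (Qᵀ * Q * Nᵀ) := by
    calc (N * Q * Nᵀ)ᵀ * (N * Q * Nᵀ) = N * Qᵀ * (Nᵀ * N) * Q * Nᵀ := by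
          simp only [transpose_mul, transpose_transpose, Matrix.mul_assoc]
      _ = N * (Qᵀ * Q * Nᵀ) := by rw [hN']; simp only [Matrix.mul_one, Matrix.mul_assoc]
  rw [fnorm, fnorm, h, trace_mul_comm, Matrix.mul_assoc, hN', Matrix.mul_one]

/-- if `γ(t) = Σᵢ λᵢ(t) nᵢ(t) ⊗ nᵢ(t)` with `λᵢ, nᵢ` differentiable at `t₀`
and `{n₁(t), n₂(t), n₃(t)}` orthonormal near `t₀`, then
`|γ'(t₀)|² = Σᵢ (λᵢ')² + Σ_{i<j} 2 (λᵢ (nⱼ·nᵢ') + λⱼ (nᵢ·nⱼ'))²`; in particular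
`|γ'(t₀)|² ≥ (λ₁')² + (λ₂')² + (λ₃')²`. -/
theorem stmt6 (lam : Fin 3 → ℝ → ℝ) (n : Fin 3 → ℝ → (Fin 3 → ℝ)) (t₀ : ℝ)
    (hlam : ∀ i, DifferentiableAt ℝ (lam i) t₀)
    (hn : ∀ i, DifferentiableAt ℝ (n i) t₀)
    (horth : ∀ᶠ t in nhds t₀, ∀ i j, n i t ⬝ᵥ n j t = if i = j then 1 else 0)
    (γ : ℝ → Matrix (Fin 3) (Fin 3) ℝ)
    (hγ : γ = fun t => ∑ i : Fin 3, lam i t • vecMulVec (n i t) (n i t)) :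
((fnorm (deriv γ t₀)) ^ 2 =
        (∑ i : Fin 3, (deriv (lam i) t₀) ^ 2) +
          ∑ i : Fin 3, ∑ j : Fin 3,
            (if i < j then
              2 * (lam i t₀ * (n j t₀ ⬝ᵥ deriv (n i) t₀)
                  + lam j t₀ * (n i t₀ ⬝ᵥ deriv (n j) t₀)) ^ 2
            else 0)) ∧
    (∑ i : Fin 3, (deriv (lam i) t₀) ^ 2) ≤ (fnorm (deriv γ t₀)) ^ 2 := by
  have h0 : ∀ i j, n i t₀ ⬝ᵥ n j t₀ = if i = j then 1 else 0 := horth.self_of_nhds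
  have hskew (i : Fin 3) : n i t₀ ⬝ᵥ deriv (n i) t₀ = 0 := by
    have h1 := hasDerivAt_dotProduct (hn i).hasDerivAt (hn i).hasDerivAt
    have h2 : (fun s => n i s ⬝ᵥ n i s) =ᶠ[nhds t₀] fun _ => (1 : ℝ) := by
      filter_upwards [horth] with s hs
      simp [hs i i]
    have h3 := h1.unique ((hasDerivAt_const t₀ (1 : ℝ)).congr_of_eventuallyEq h2)
    rw [dotProduct_comm (deriv (n i) t₀)] at h3
    linarith
  have hderiv : deriv γ t₀ = ∑ k : Fin 3, (deriv (lam k) t₀ • vecMulVec (n k t₀) (n k t₀)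
      + lam k t₀ • (vecMulVec (deriv (n k) t₀) (n k t₀)
        + vecMulVec (n k t₀) (deriv (n k) t₀))) := by
    refine (hasDerivAt_matrix_of_entries fun a b => ?_).deriv
    simp only [hγ, Matrix.sum_apply, Matrix.smul_apply, Matrix.add_apply, vecMulVec_apply,
      smul_eq_mul]
    exact HasDerivAt.fun_sum fun k _ => (hlam k).hasDerivAt.fun_mul
      ((hasDerivAt_pi.1 (hn k).hasDerivAt a).fun_mul (hasDerivAt_pi.1 (hn k).hasDerivAt b))
  let N : Matrix (Fin 3) (Fin 3) ℝ := of fun i => n i t₀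
  have hN : N * Nᵀ = 1 := by
    ext i j
    rw [one_apply, ← h0 i j]
    rfl
  have hentry (i j : Fin 3) : (N * deriv γ t₀ * Nᵀ) i j =
      (if i = j then deriv (lam i) t₀ else 0) + (lam i t₀ * (n j t₀ ⬝ᵥ deriv (n i) t₀)
        + lam j t₀ * (n i t₀ ⬝ᵥ deriv (n j) t₀)) := by
    have hform (Q : Matrix (Fin 3) (Fin 3) ℝ) :
        (N * Q * Nᵀ) i j = n i t₀ ⬝ᵥ (Q *ᵥ n j t₀) := by
      rw [Matrix.mul_assoc]
      rfl
    have hrank (u v : Fin 3 → ℝ) :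
        n i t₀ ⬝ᵥ (vecMulVec u v *ᵥ n j t₀) = (n i t₀ ⬝ᵥ u) * (v ⬝ᵥ n j t₀) := by
      rw [vecMulVec_mulVec, op_smul_eq_smul, dotProduct_smul, smul_eq_mul, mul_comm]
    rw [hform, hderiv]
    simp only [sum_mulVec, add_mulVec, smul_mulVec, dotProduct_sum, dotProduct_add,
      dotProduct_smul, hrank, h0, smul_eq_mul, dotProduct_comm _ (n j t₀)]
    fin_cases i <;> fin_cases j <;> simp [Fin.sum_univ_three] <;> ring
  have main : fnorm (deriv γ t₀) ^ 2 = (∑ i : Fin 3, (deriv (lam i) t₀) ^ 2) +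
      ∑ i : Fin 3, ∑ j : Fin 3, (if i < j then
        2 * (lam i t₀ * (n j t₀ ⬝ᵥ deriv (n i) t₀)
          + lam j t₀ * (n i t₀ ⬝ᵥ deriv (n j) t₀)) ^ 2 else 0) := by
    rw [← fnorm_conj hN, fnorm_sq]
    simp only [hentry]
    simp [Fin.sum_univ_three, hskew]
    ring
  refine ⟨main, main ▸ le_add_of_nonneg_right ?_⟩
  exact Finset.sum_nonneg fun i _ => Finset.sum_nonneg fun j _ => by split_ifs <;> positivity
end
end

section
/- Every symmetric traceless 3×3 real matrix Q can be written as Q = (s + r/3)(n₃⊗n₃ − (1/3)I₃) + (2r/3)(n₂⊗n₂ − (1/3)I₃), where λ₁ ≤ λ₂ ≤ λ₃ are the eigenvalues of Q, n₂ and n₃ are orthonormal eigenvectors for λ₂ and λ₃ respectively, s = (3/2)λ₃ and r = (3/2)(λ₂ − λ₁). -/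
open Matrix

noncomputable section

/-- An orthonormal family of full size resolves the identity. -/
theorem one_eq_sum_vecMulVec {ι : Type*} [Fintype ι] [DecidableEq ι] {n : ι → ι → ℝ}
    (hn : ∀ i j, n i ⬝ᵥ n j = if i = j then 1 else 0) :
    (1 : Matrix ι ι ℝ) = ∑ k, vecMulVec (n k) (n k) := by
  have h : Matrix.of n * (Matrix.of n)ᵀ = 1 := by
    ext i j
    simpa [Matrix.mul_apply, dotProduct, Matrix.one_apply] using hn i j
  rw [← mul_eq_one_comm.mp h]
  ext i j
  simp [Matrix.mul_apply, Matrix.sum_apply, vecMulVec_apply]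

/-- Spectral decomposition of a matrix with an orthonormal eigenbasis. -/
theorem eq_sum_smul_vecMulVec {ι : Type*} [Fintype ι] [DecidableEq ι] {Q : Matrix ι ι ℝ}
    {lam : ι → ℝ} {n : ι → ι → ℝ} (hn : ∀ i j, n i ⬝ᵥ n j = if i = j then 1 else 0)
    (he : ∀ i, Q *ᵥ n i = lam i • n i) :
    Q = ∑ k, lam k • vecMulVec (n k) (n k) := by
  conv_lhs => rw [← Matrix.mul_one Q, one_eq_sum_vecMulVec hn]
  simp [Finset.mul_sum, mul_vecMulVec, he, smul_vecMulVec]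

/-- every symmetric traceless `3 × 3` real matrix `Q` can be written as
`Q = (s + r/3)(n₃ ⊗ n₃ − I₃/3) + (2r/3)(n₂ ⊗ n₂ − I₃/3)`, where `λ₁ ≤ λ₂ ≤ λ₃` are the
eigenvalues of `Q` (with an orthonormal eigenbasis `n₁, n₂, n₃`), `s = (3/2) λ₃` and
`r = (3/2)(λ₂ − λ₁)`. -/
theorem stmt8 (Q : Matrix (Fin 3) (Fin 3) ℝ) (hQ : Q.IsSymm) (hQt : Q.trace = 0) :
    ∃ (lam : Fin 3 → ℝ) (n : Fin 3 → (Fin 3 → ℝ)),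
      (∀ i j, n i ⬝ᵥ n j = if i = j then 1 else 0) ∧
      (∀ i, Q *ᵥ n i = lam i • n i) ∧
      lam 0 ≤ lam 1 ∧ lam 1 ≤ lam 2 ∧
      Q = (3 / 2 * lam 2 + (3 / 2 * (lam 1 - lam 0)) / 3) •
            (vecMulVec (n 2) (n 2) - (1 / 3 : ℝ) • (1 : Matrix (Fin 3) (Fin 3) ℝ)) +
          (2 * (3 / 2 * (lam 1 - lam 0)) / 3) •
            (vecMulVec (n 1) (n 1) - (1 / 3 : ℝ) • (1 : Matrix (Fin 3) (Fin 3) ℝ)) := by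
  have hH : Q.IsHermitian := by
    rw [Matrix.IsHermitian, conjTranspose_eq_transpose_of_trivial]; exact hQ
  let σ := Tuple.sort hH.eigenvalues
  let lam : Fin 3 → ℝ := fun i => hH.eigenvalues (σ i)
  let n : Fin 3 → Fin 3 → ℝ := fun i => (hH.eigenvectorBasis (σ i)).ofLp
  have hmono : Monotone lam := Tuple.monotone_sort hH.eigenvalues
  have hn : ∀ i j, n i ⬝ᵥ n j = if i = j then 1 else 0 := by
    intro i j
    have h := orthonormal_iff_ite.mp hH.eigenvectorBasis.orthonormal (σ i) (σ j)
    rw [EuclideanSpace.inner_eq_star_dotProduct, star_trivial, dotProduct_comm] at h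
    simpa [n] using h
  have he : ∀ i, Q *ᵥ n i = lam i • n i := fun i => hH.mulVec_eigenvectorBasis (σ i)
  refine ⟨lam, n, hn, he, hmono (by decide), hmono (by decide), ?_⟩
  have hone := one_eq_sum_vecMulVec hn
  have hQs := eq_sum_smul_vecMulVec hn he
  have htr : lam 0 + lam 1 + lam 2 = 0 := by
    rw [hQs] at hQt
    simpa [trace_sum, trace_vecMulVec, hn, Fin.sum_univ_three] using hQt
  have hlam : lam 2 = -lam 0 - lam 1 := by linarith
  rw [Fin.sum_univ_three] at hone hQs
  rw [hQs, hone, hlam]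
  module
end
end

section
/- Assume a, c > 0 and b² = 27ac, set s₊ := √(3a/c) and f(s) := (c/9)s²(s − s₊)². The optimal profile S(z) := (s₊/2)(1 + tanh(√a·z/2)) is strictly increasing, satisfies 0 < S(z) < s₊ for all z ∈ ℝ, S(z) → 0 as z → −∞, S(z) → s₊ as z → +∞, and solves the ODE S'(z) = √(3 f(S(z))) for all z ∈ ℝ. -/
noncomputable section

/-- The optimal transition profile `S(z) = (s₊/2)(1 + tanh(√a z / 2))`, `s₊ = √(3a/c)`. -/
def Sprof (a c : ℝ) (z : ℝ) : ℝ :=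
  Real.sqrt (3 * a / c) / 2 * (1 + Real.tanh (Real.sqrt a * z / 2))

/-- The bulk energy on uniaxial states in factorized form: `f(s) = (c/9) s² (s − s₊)²`. -/
def fbfac (a c s : ℝ) : ℝ := c / 9 * s ^ 2 * (s - Real.sqrt (3 * a / c)) ^ 2

/-- The profile is a rescaled logistic sigmoid. -/
theorem Sprof_eq_sigmoid (a c z : ℝ) :
    Sprof a c z = Real.sqrt (3 * a / c) * Real.sigmoid (Real.sqrt a * z) := by
  have h := Real.exp_pos (Real.sqrt a * z / 2)
  have h1 : Real.exp (-(Real.sqrt a * z)) = (Real.exp (Real.sqrt a * z / 2) ^ 2)⁻¹ := by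
    rw [← Real.exp_nat_mul, ← Real.exp_neg]
    congr 1
    push_cast
    ring
  rw [Sprof, Real.tanh_eq, Real.sigmoid_def, h1, Real.exp_neg]
  field_simp
  ring

/-- the optimal profile `S` is strictly increasing, takes values in `(0, s₊)`,
tends to `0` at `−∞` and to `s₊` at `+∞`, and solves the ODE `S'(z) = √(3 f(S(z)))`. -/
theorem stmt9 (a b c : ℝ) (ha : 0 < a) (hc : 0 < c) (habc : b ^ 2 = 27 * a * c) :
    StrictMono (Sprof a c) ∧
    (∀ z : ℝ, 0 < Sprof a c z ∧ Sprof a c z < Real.sqrt (3 * a / c)) ∧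
    Filter.Tendsto (Sprof a c) Filter.atBot (nhds 0) ∧
    Filter.Tendsto (Sprof a c) Filter.atTop (nhds (Real.sqrt (3 * a / c))) ∧
    (∀ z : ℝ, HasDerivAt (Sprof a c) (Real.sqrt (3 * fbfac a c (Sprof a c z))) z) := by
  have hs : 0 < Real.sqrt (3 * a / c) := Real.sqrt_pos.mpr (by positivity)
  have hr : 0 < Real.sqrt a := Real.sqrt_pos.mpr ha
  have hS : Sprof a c = fun z ↦ Real.sqrt (3 * a / c) * Real.sigmoid (Real.sqrt a * z) :=
    funext (Sprof_eq_sigmoid a c)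
  rw [hS]
  refine ⟨fun x y hxy ↦ ?_, fun z ↦ ⟨mul_pos hs (Real.sigmoid_pos _), ?_⟩, ?_, ?_, fun z ↦ ?_⟩
  · exact mul_lt_mul_of_pos_left
      (Real.sigmoid_strictMono (mul_lt_mul_of_pos_left hxy hr)) hs
  · exact mul_lt_of_lt_one_right hs (Real.sigmoid_lt_one _)
  · simpa using (Real.tendsto_sigmoid_atBot.comp
      (Filter.tendsto_id.const_mul_atBot hr)).const_mul (Real.sqrt (3 * a / c))
  · simpa using (Real.tendsto_sigmoid_atTop.comp
      (Filter.tendsto_id.const_mul_atTop hr)).const_mul (Real.sqrt (3 * a / c))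
  · have hd := ((Real.hasDerivAt_sigmoid (Real.sqrt a * z)).comp z
      ((hasDerivAt_id z).const_mul (Real.sqrt a))).const_mul (Real.sqrt (3 * a / c))
    refine hd.congr_deriv (Eq.symm ?_)
    have h0 := Real.sigmoid_pos (Real.sqrt a * z)
    have h1 := sub_pos.mpr (Real.sigmoid_lt_one (Real.sqrt a * z))
    rw [mul_one, Real.sqrt_eq_iff_mul_self_eq_of_pos
      (mul_pos hs (mul_pos (mul_pos h0 h1) hr))]
    have hs2 : Real.sqrt (3 * a / c) ^ 2 = 3 * a / c := Real.sq_sqrt (by positivity)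
    have hr2 : Real.sqrt a ^ 2 = a := Real.sq_sqrt ha.le
    have hc2 : c * Real.sqrt (3 * a / c) ^ 2 = 3 * Real.sqrt a ^ 2 := by
      rw [hs2, hr2]
      field_simp
    rw [fbfac]
    linear_combination (-(1 / 3) * Real.sqrt (3 * a / c) ^ 2 * Real.sigmoid (Real.sqrt a * z) ^ 2 *
      (1 - Real.sigmoid (Real.sqrt a * z)) ^ 2) * hc2
end
end

section
/- Let g : 𝒬 → ℝ be differentiable and isotropic, i.e. g(RᵀQR) = g(Q) for every Q ∈ 𝒬 and every orthogonal matrix R ∈ O(3). Then for every Q ∈ 𝒬 the gradient ∇g(Q) ∈ 𝒬 (taken with respect to the Frobenius inner product on 𝒬) commutes with Q: ∇g(Q)·Q = Q·∇g(Q). -/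
open Matrix

noncomputable section

attribute [local instance] Matrix.frobeniusNormedAddCommGroup Matrix.frobeniusNormedSpace

theorem orthogonal_exp_of_skew {W : Matrix (Fin 3) (Fin 3) ℝ} (hW : Wᵀ = -W) :
    (NormedSpace.exp W)ᵀ * NormedSpace.exp W = 1 := by
  rw [← Matrix.exp_transpose, hW, ← Matrix.exp_add_of_commute _ _ (Commute.refl W).neg_left,
    neg_add_cancel, NormedSpace.exp_zero]

attribute [local instance] Matrix.frobeniusNormedRing Matrix.frobeniusNormedAlgebra in
theorem hasDerivAt_exp_smul_matrix (W : Matrix (Fin 3) (Fin 3) ℝ) :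
    HasDerivAt (fun t : ℝ => NormedSpace.exp (t • W)) W 0 := by
  have h := hasDerivAt_exp_smul_const (𝕂 := ℝ) W (0 : ℝ)
  rw [zero_smul, NormedSpace.exp_zero, one_mul] at h
  exact h

attribute [local instance] Matrix.frobeniusNormedRing Matrix.frobeniusNormedAlgebra in
theorem hasDerivAt_conj_exp {W : Matrix (Fin 3) (Fin 3) ℝ} (hW : Wᵀ = -W)
    (Q : Matrix (Fin 3) (Fin 3) ℝ) :
    HasDerivAt (fun t : ℝ => (NormedSpace.exp (t • W))ᵀ * Q * NormedSpace.exp (t • W))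
      (Q * W - W * Q) 0 := by
  have hT : HasDerivAt (fun t : ℝ => (NormedSpace.exp (t • W))ᵀ) (-W) 0 := by
    simpa [← Matrix.exp_transpose, hW] using hasDerivAt_exp_smul_matrix (-W)
  have h := (hT.mul_const Q).mul (hasDerivAt_exp_smul_matrix W)
  simp only [zero_smul, NormedSpace.exp_zero, transpose_one, one_mul, mul_one] at h
  rw [neg_mul, neg_add_eq_sub] at h
  exact h

theorem isQ.conj {Q R : Matrix (Fin 3) (Fin 3) ℝ} (hQ : isQ Q) (hR : Rᵀ * R = 1) :
    isQ (Rᵀ * Q * R) := by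
  refine ⟨?_, ?_⟩
  · simp [Matrix.IsSymm, Matrix.transpose_mul, hQ.1.eq, Matrix.mul_assoc]
  · rw [Matrix.trace_mul_comm, ← Matrix.mul_assoc, mul_eq_one_comm.mp hR, one_mul, hQ.2]

theorem isQ.commutator_skew {Q W : Matrix (Fin 3) (Fin 3) ℝ} (hQ : isQ Q) (hW : Wᵀ = -W) :
    isQ (Q * W - W * Q) := by
  refine ⟨?_, ?_⟩
  · rw [Matrix.IsSymm, Matrix.transpose_sub, Matrix.transpose_mul, Matrix.transpose_mul,
      hQ.1.eq, hW]
    simp only [neg_mul, mul_neg]; abel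
  · rw [Matrix.trace_sub, Matrix.trace_mul_comm, sub_self]

/-- if `g : 𝒬 → ℝ` is differentiable on `𝒬` with gradient `G Q ∈ 𝒬`
(characterized by `⟨G Q, P⟩ = (d/dt)|₀ g(Q + tP)` for all `P ∈ 𝒬`, with respect to the
Frobenius inner product) and `g` is isotropic, i.e. `g(Rᵀ Q R) = g(Q)` for all orthogonal
`R ∈ O(3)`, then the gradient commutes with `Q`: `G Q · Q = Q · G Q` for all `Q ∈ 𝒬`. -/
theorem stmt11 (g : Matrix (Fin 3) (Fin 3) ℝ → ℝ)
    (G : Matrix (Fin 3) (Fin 3) ℝ → Matrix (Fin 3) (Fin 3) ℝ)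
    (hG : ∀ Q, isQ Q → isQ (G Q))
    (hdiff : ∀ Q, isQ Q → ∃ L : Matrix (Fin 3) (Fin 3) ℝ →L[ℝ] ℝ,
      HasFDerivWithinAt g L {p | isQ p} Q ∧
      ∀ P, isQ P → L P = ((G Q)ᵀ * P).trace)
    (hiso : ∀ Q, isQ Q → ∀ R : Matrix (Fin 3) (Fin 3) ℝ, Rᵀ * R = 1 →
      g (Rᵀ * Q * R) = g Q) :
    ∀ Q, isQ Q → G Q * Q = Q * G Q := by
  intro Q hQ
  obtain ⟨L, hL, hLG⟩ := hdiff Q hQ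
  have hGs := (hG Q hQ).1.eq
  set W := G Q * Q - Q * G Q with hWdef
  have hW : Wᵀ = -W := by
    rw [hWdef, Matrix.transpose_sub, Matrix.transpose_mul, Matrix.transpose_mul, hQ.1.eq, hGs,
      neg_sub]
  have horth (t : ℝ) : (NormedSpace.exp (t • W))ᵀ * NormedSpace.exp (t • W) = 1 :=
    orthogonal_exp_of_skew (by rw [Matrix.transpose_smul, hW, smul_neg])
  have hQ0 : (NormedSpace.exp ((0 : ℝ) • W))ᵀ * Q * NormedSpace.exp ((0 : ℝ) • W) = Q := by
    simp
  have hcomp : HasDerivAt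
      (fun t : ℝ => g ((NormedSpace.exp (t • W))ᵀ * Q * NormedSpace.exp (t • W)))
      (L (Q * W - W * Q)) 0 := by
    rw [← hasDerivWithinAt_univ]
    exact HasFDerivWithinAt.comp_hasDerivWithinAt (t := {p | isQ p}) (0 : ℝ)
      (by rw [hQ0]; exact hL) (hasDerivAt_conj_exp hW Q).hasDerivWithinAt
      fun t _ => hQ.conj (horth t)
  have hconst : L (Q * W - W * Q) = 0 := by
    refine hcomp.unique ?_
    simp_rw [fun t => hiso Q hQ _ (horth t)]
    exact hasDerivAt_const _ _
  rw [hLG _ (hQ.commutator_skew hW), hGs] at hconst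
  have htr : (G Q * (Q * W - W * Q)).trace = (W * W).trace := by
    rw [Matrix.mul_sub, Matrix.trace_sub, ← Matrix.mul_assoc, ← Matrix.mul_assoc,
      Matrix.trace_mul_comm (G Q * W) Q, ← Matrix.mul_assoc, ← Matrix.trace_sub,
      ← Matrix.sub_mul]
  have hzero : (Wᴴ * W).trace = 0 := by
    rw [Matrix.conjTranspose_eq_transpose_of_trivial, hW, neg_mul, Matrix.trace_neg, ← htr,
      hconst, neg_zero]
  exact sub_eq_zero.mp (Matrix.trace_conjTranspose_mul_self_eq_zero_iff.mp hzero)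
end
end

section
/- Let U ⊆ ℝᵈ be open, T > 0, ε > 0, and let Q : U × (0,T) → 𝒬 be a C² solution of the Landau–De Gennes gradient flow ∂_t Q = ΔQ − ε^{−2} ∇_q F(Q) on U × (0,T). Then the commutator identity [∂_t Q, Q] = Σ_{j=1}^{d} ∂_j [∂_j Q, Q] holds pointwise on U × (0,T), where [A,B] := AB − BA. -/
open Matrix

noncomputable section

/-- The gradient in `𝒬` of the bulk energy density:
`(∇_q F(Q))_{ij} = a Q_{ij} − b (Q²)_{ij} + c |Q|² Q_{ij} + (b/3) |Q|² δ_{ij}`. -/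
def gradF (a b c : ℝ) (Q : Matrix (Fin 3) (Fin 3) ℝ) : Matrix (Fin 3) (Fin 3) ℝ :=
  a • Q - b • (Q * Q) + (c * (Qᵀ * Q).trace) • Q +
    (b / 3 * (Qᵀ * Q).trace) • (1 : Matrix (Fin 3) (Fin 3) ℝ)

/-- The `j`-th spatial partial derivative of a matrix-valued field, taken entrywise. -/
def pdM (d : ℕ) (j : Fin d) (f : (Fin d → ℝ) → Matrix (Fin 3) (Fin 3) ℝ)
    (x : Fin d → ℝ) : Matrix (Fin 3) (Fin 3) ℝ :=
  Matrix.of fun i k => fderiv ℝ (fun y => f y i k) x (Pi.single j 1)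

/-- The time derivative of a matrix-valued field, taken entrywise. -/
def tdM (d : ℕ) (Q : (Fin d → ℝ) → ℝ → Matrix (Fin 3) (Fin 3) ℝ)
    (x : Fin d → ℝ) (t : ℝ) : Matrix (Fin 3) (Fin 3) ℝ :=
  Matrix.of fun i k => deriv (fun s => Q x s i k) t

theorem pdM_sub {d : ℕ} (j : Fin d) {f g : (Fin d → ℝ) → Matrix (Fin 3) (Fin 3) ℝ}
    {x : Fin d → ℝ} (hf : ∀ i k, DifferentiableAt ℝ (fun y => f y i k) x)
    (hg : ∀ i k, DifferentiableAt ℝ (fun y => g y i k) x) :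
    pdM d j (fun y => f y - g y) x = pdM d j f x - pdM d j g x := by
  ext i k
  simp only [pdM, Matrix.of_apply, Matrix.sub_apply]
  rw [fderiv_fun_sub (hf i k) (hg i k)]
  rfl

theorem differentiableAt_matrix_mul_apply {d : ℕ}
    {f g : (Fin d → ℝ) → Matrix (Fin 3) (Fin 3) ℝ}
    {x : Fin d → ℝ} (hf : ∀ i k, DifferentiableAt ℝ (fun y => f y i k) x)
    (hg : ∀ i k, DifferentiableAt ℝ (fun y => g y i k) x) (i k : Fin 3) :
    DifferentiableAt ℝ (fun y => (f y * g y) i k) x := by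
  simp only [Matrix.mul_apply]
  exact DifferentiableAt.fun_sum fun l _ => (hf i l).fun_mul (hg l k)

/-- The Leibniz rule for the entrywise partial derivative of a matrix product. -/
theorem pdM_mul {d : ℕ} (j : Fin d) {f g : (Fin d → ℝ) → Matrix (Fin 3) (Fin 3) ℝ}
    {x : Fin d → ℝ} (hf : ∀ i k, DifferentiableAt ℝ (fun y => f y i k) x)
    (hg : ∀ i k, DifferentiableAt ℝ (fun y => g y i k) x) :
    pdM d j (fun y => f y * g y) x = pdM d j f x * g x + f x * pdM d j g x := by
  ext i k
  simp only [pdM, Matrix.of_apply, Matrix.mul_apply, Matrix.add_apply]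
  rw [fderiv_fun_sum fun l _ => (hf i l).fun_mul (hg l k), _root_.sum_apply,
    ← Finset.sum_add_distrib]
  refine Finset.sum_congr rfl fun l _ => ?_
  rw [fderiv_fun_mul (hf i l) (hg l k)]
  simp only [_root_.add_apply, _root_.smul_apply, smul_eq_mul]
  ring

theorem commute_gradF (a b c : ℝ) (Q : Matrix (Fin 3) (Fin 3) ℝ) :
    Commute (gradF a b c Q) Q := by
  have h : Commute Q Q := Commute.refl Q
  exact (((h.smul_left a).sub_left ((h.mul_left h).smul_left b)).add_left
    (h.smul_left _)).add_left ((Commute.one_left Q).smul_left _)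

/-- any `C²` solution `Q : U × (0,T) → 𝒬` of the Landau–De Gennes gradient
flow `∂_t Q = ΔQ − ε^{−2} ∇_q F(Q)` satisfies the commutator identity
`[∂_t Q, Q] = Σ_j ∂_j [∂_j Q, Q]` pointwise on `U × (0,T)`. -/
theorem stmt16 (a b c : ℝ) (d : ℕ) (U : Set (Fin d → ℝ)) (hU : IsOpen U)
    (T ε : ℝ) (hT : 0 < T) (hε : 0 < ε)
    (Q : (Fin d → ℝ) → ℝ → Matrix (Fin 3) (Fin 3) ℝ)
    (hQval : ∀ x ∈ U, ∀ t ∈ Set.Ioo (0 : ℝ) T, isQ (Q x t))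
    (hC2 : ∀ i k : Fin 3, ContDiffOn ℝ 2
      (fun p : (Fin d → ℝ) × ℝ => Q p.1 p.2 i k) (U ×ˢ Set.Ioo (0 : ℝ) T))
    (hPDE : ∀ x ∈ U, ∀ t ∈ Set.Ioo (0 : ℝ) T,
      tdM d Q x t =
        (∑ j : Fin d, pdM d j (pdM d j fun y => Q y t) x) - (ε ^ 2)⁻¹ • gradF a b c (Q x t)) :
    ∀ x ∈ U, ∀ t ∈ Set.Ioo (0 : ℝ) T,
      tdM d Q x t * Q x t - Q x t * tdM d Q x t =
        ∑ j : Fin d, pdM d j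
          (fun y => pdM d j (fun y' => Q y' t) y * Q y t
            - Q y t * pdM d j (fun y' => Q y' t) y) x := by
  intro x hx t ht
  have hq (i k : Fin 3) : ContDiffOn ℝ 2 (fun y => Q y t i k) U :=
    (hC2 i k).comp (f := fun y => (y, t)) (contDiff_id.prodMk contDiff_const).contDiffOn
      fun y hy => ⟨hy, ht⟩
  have hQ (i k : Fin 3) : DifferentiableAt ℝ (fun y => Q y t i k) x :=
    ((hq i k).contDiffAt (hU.mem_nhds hx)).differentiableAt (by norm_num)
  have hdQ (j : Fin d) (i k : Fin 3) :
      DifferentiableAt ℝ (fun y => pdM d j (fun y' => Q y' t) y i k) x := by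
    have h : DifferentiableAt ℝ (fderiv ℝ fun y => Q y t i k) x :=
      (((hq i k).contDiffAt (hU.mem_nhds hx)).fderiv_right (m := 1)
        (by norm_num)).differentiableAt (by norm_num)
    exact h.clm_apply (differentiableAt_const _)
  have hterm (j : Fin d) : pdM d j
      (fun y => pdM d j (fun y' => Q y' t) y * Q y t
        - Q y t * pdM d j (fun y' => Q y' t) y) x =
      pdM d j (pdM d j fun y => Q y t) x * Q x t
        - Q x t * pdM d j (pdM d j fun y => Q y t) x := by
    rw [pdM_sub j (differentiableAt_matrix_mul_apply (hdQ j) hQ)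
      (differentiableAt_matrix_mul_apply hQ (hdQ j)), pdM_mul j (hdQ j) hQ, pdM_mul j hQ (hdQ j)]
    abel
  have hcomm := ((commute_gradF a b c (Q x t)).smul_left (ε ^ 2)⁻¹).eq
  rw [Finset.sum_congr rfl fun j _ => hterm j, Finset.sum_sub_distrib, ← Finset.sum_mul,
    ← Finset.mul_sum, hPDE x hx t ht, sub_mul, mul_sub, hcomm]
  abel
end
end
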